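/- arXiv:math/0405211 — 2 statements merged into one kernel-verified Lean document; each statement's English description precedes it below -/
import Mathlib

section
/- Let G be a group and let A and B be finite groups. Then the iterated wreath product (G ≀ A) ≀ B embeds (there is an injective group homomorphism) into the semidirect product (A × B → G) ⋊ (A ≀ B), where A ≀ B acts on A × B by (f, b)·(a, c) = (f(b c)·a, b c) and acts on functions A × B → G by precomposition with the inverse of this action. -/
/-- The permutation group of `X` acts on functions `X → G` by precomposition with
the inverse permutation: `(σ • f) x = f (σ⁻¹ x)`. -/
def permToAut (X G : Type*) [Group G] : Equiv.Perm X →* MulAut (X → G) where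
  toFun σ := MulEquiv.arrowCongr σ (MulEquiv.refl G)
  map_one' := rfl
  map_mul' _ _ := rfl

/-- The action of `L` on `L → G` by `(l • f) x = f (l⁻¹ * x)`, as a homomorphism
`L →* MulAut (L → G)`. -/
def wreathAut (G L : Type*) [Group G] [Group L] : L →* MulAut (L → G) :=
  (permToAut L G).comp (MulAction.toPermHom L L)

/-- The wreath product `G ≀ L`, i.e. the semidirect product `(L → G) ⋊ L` where `L`
acts on functions `L → G` by `(l • f) x = f (l⁻¹ * x)`. -/
abbrev Wreath (G L : Type*) [Group G] [Group L] : Type _ :=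
  SemidirectProduct (L → G) L (wreathAut G L)

/-- The left action of the wreath product `A ≀ B` on the set `A × B`, given by
`(f, b) • (a, c) = (f (b * c) * a, b * c)`, as a homomorphism to the permutation
group of `A × B`. -/
def baseAct (A B : Type*) [Group A] [Group B] : Wreath A B →* Equiv.Perm (A × B) where
  toFun w :=
    { toFun := fun p => (w.left (w.right * p.2) * p.1, w.right * p.2)
      invFun := fun p => ((w.left p.2)⁻¹ * p.1, w.right⁻¹ * p.2)
      left_inv := by intro p; simp [mul_assoc]
      right_inv := by intro p; simp [← mul_assoc] }
  map_one' := by ext p <;> simp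
  map_mul' w₁ w₂ := by
    ext p
    · change w₁.left (w₁.right * w₂.right * p.2) *
          w₂.left (w₁.right⁻¹ * (w₁.right * w₂.right * p.2)) * p.1 =
        w₁.left (w₁.right * (w₂.right * p.2)) * (w₂.left (w₂.right * p.2) * p.1)
      simp [mul_assoc]
    · simp [mul_assoc]

/-- The homomorphism `(G ≀ A) ≀ B →* (A × B → G) ⋊ (A ≀ B)` that collects the `G`-components
into a function on `A × B` and the `A`-components into an element of `A ≀ B`. -/
def iteratedWreathHom (G A B : Type*) [Group G] [Group A] [Group B] :
    Wreath (Wreath G A) B →*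
      SemidirectProduct (A × B → G) (Wreath A B)
        ((permToAut (A × B) G).comp (baseAct A B)) where
  toFun w := ⟨fun p => (w.left p.2).left p.1, ⟨fun c => (w.left c).right, w.right⟩⟩
  map_one' := rfl
  map_mul' _ _ := rfl

theorem iteratedWreathHom_injective (G A B : Type*) [Group G] [Group A] [Group B] :
    Function.Injective (iteratedWreathHom G A B) := by
  intro w₁ w₂ h
  have hG : (fun p : A × B => (w₁.left p.2).left p.1) = fun p => (w₂.left p.2).left p.1 :=
    congrArg SemidirectProduct.left h
  have hA : (fun c => (w₁.left c).right) = fun c => (w₂.left c).right :=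
    congrArg (fun z => z.right.left) h
  have hB : w₁.right = w₂.right := congrArg (fun z => z.right.right) h
  refine SemidirectProduct.ext (funext fun c => SemidirectProduct.ext (funext fun a => ?_) ?_) hB
  · exact congrFun hG (a, c)
  · exact congrFun hA c

/-- For a group `G` and finite groups `A`, `B`, the iterated wreath
product `(G ≀ A) ≀ B` embeds into the semidirect product `(A × B → G) ⋊ (A ≀ B)`,
where `A ≀ B` acts on `A × B` by `(f, b) • (a, c) = (f (b * c) * a, b * c)` and on
functions `A × B → G` by precomposition with the inverse of this action. -/
theorem iterated_wreath_embeds (G A B : Type*) [Group G] [Group A] [Group B]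
    [Finite A] [Finite B] :
    ∃ φ : Wreath (Wreath G A) B →*
        SemidirectProduct (A × B → G) (Wreath A B)
          ((permToAut (A × B) G).comp (baseAct A B)),
      Function.Injective φ :=
  ⟨iteratedWreathHom G A B, iteratedWreathHom_injective G A B⟩
end

section
/- In the setting of the amalgamated product G of G₁ = F₁ × ℤ and G₂ = F₂ × ℤ along E = ℤ × ℤ via j₁(m, n) = λ₁^m μ₁^n and j₂(m, n) = λ₂^{p₁m + p₂n} μ₂^{q₁m + q₂n}, with g₁, g₂ ≥ 1 and p₁q₂ − p₂q₁ = 1: if p₂ ≠ 0, then the intersection of the commutator subgroup [G, G] with the image κ₂(G₂) contains a subgroup isomorphic to ℤ × ℤ, and hence is not a free group. -/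
open Monoid

/-- `F g`: the free group on the `2g` generators `a₁, b₁, …, a_g, b_g`; the generator
`aᵢ` is `FreeGroup.of (i, false)` and `bᵢ` is `FreeGroup.of (i, true)`. -/
abbrev SurfaceAmalgam.F (g : ℕ) : Type :=
  FreeGroup (Fin g × Bool)

namespace SurfaceAmalgam

/-- `G g = F g × ℤ` (with `ℤ` written multiplicatively). -/
abbrev G (g : ℕ) : Type := F g × Multiplicative ℤ

/-- `λ = (1, 1) ∈ F g × ℤ`: the generator of the (multiplicative) `ℤ` factor. -/
def lam (g : ℕ) : G g := (1, Multiplicative.ofAdd 1)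

open scoped commutatorElement in
/-- `μ = (∏ᵢ [aᵢ, bᵢ], 0) ∈ F g × ℤ`, where `[x, y] = x y x⁻¹ y⁻¹`. -/
def mu (g : ℕ) : G g :=
  (((List.finRange g).map fun i =>
      ⁅FreeGroup.of ((i, false) : Fin g × Bool), FreeGroup.of ((i, true) : Fin g × Bool)⁆).prod,
    1)

/-- `j₁ (m, n) = λ₁ ^ m * μ₁ ^ n : E = ℤ × ℤ → G g₁`. -/
def j₁ (g : ℕ) (e : ℤ × ℤ) : G g := lam g ^ e.1 * mu g ^ e.2

/-- `j₂ (m, n) = λ₂ ^ (p₁ m + p₂ n) * μ₂ ^ (q₁ m + q₂ n) : E = ℤ × ℤ → G g₂`. -/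
def j₂ (g : ℕ) (p₁ q₁ p₂ q₂ : ℤ) (e : ℤ × ℤ) : G g :=
  lam g ^ (p₁ * e.1 + p₂ * e.2) * mu g ^ (q₁ * e.1 + q₂ * e.2)

/-- The normal subgroup of the free product `G g₁ * G g₂` generated by the relations
identifying `j₁ e` with `j₂ e` for all `e ∈ E = ℤ × ℤ`. -/
def rels (g₁ g₂ : ℕ) (p₁ q₁ p₂ q₂ : ℤ) : Subgroup (Coprod (G g₁) (G g₂)) :=
  Subgroup.normalClosure
    {x | ∃ e : ℤ × ℤ, x = Coprod.inl (j₁ g₁ e) * (Coprod.inr (j₂ g₂ p₁ q₁ p₂ q₂ e))⁻¹}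

instance (g₁ g₂ : ℕ) (p₁ q₁ p₂ q₂ : ℤ) : (rels g₁ g₂ p₁ q₁ p₂ q₂).Normal :=
  Subgroup.normalClosure_normal

/-- The amalgamated free product (pushout) of `G g₁` and `G g₂` along `E = ℤ × ℤ` via
`j₁` and `j₂`: the quotient of the free product `G g₁ * G g₂` identifying `j₁ e` with
`j₂ e` for all `e ∈ E`. -/
def Amalgam (g₁ g₂ : ℕ) (p₁ q₁ p₂ q₂ : ℤ) : Type :=
  Coprod (G g₁) (G g₂) ⧸ rels g₁ g₂ p₁ q₁ p₂ q₂

instance (g₁ g₂ : ℕ) (p₁ q₁ p₂ q₂ : ℤ) : Group (Amalgam g₁ g₂ p₁ q₁ p₂ q₂) :=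
  inferInstanceAs (Group (Coprod (G g₁) (G g₂) ⧸ rels g₁ g₂ p₁ q₁ p₂ q₂))

/-- The canonical homomorphism `κ₁ : G g₁ →* G`. -/
def κ₁ (g₁ g₂ : ℕ) (p₁ q₁ p₂ q₂ : ℤ) : G g₁ →* Amalgam g₁ g₂ p₁ q₁ p₂ q₂ :=
  (QuotientGroup.mk' (rels g₁ g₂ p₁ q₁ p₂ q₂)).comp Coprod.inl

/-- The canonical homomorphism `κ₂ : G g₂ →* G`. -/
def κ₂ (g₁ g₂ : ℕ) (p₁ q₁ p₂ q₂ : ℤ) : G g₂ →* Amalgam g₁ g₂ p₁ q₁ p₂ q₂ :=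
  (QuotientGroup.mk' (rels g₁ g₂ p₁ q₁ p₂ q₂)).comp Coprod.inr

end SurfaceAmalgam

namespace SurfaceAmalgam

theorem commute_lam (g : ℕ) (x : G g) : Commute (lam g) x :=
  Prod.ext ((one_mul _).trans (mul_one _).symm) (mul_comm _ _)

/-- `j₂` as a group homomorphism on `ℤ × ℤ`, written multiplicatively. -/
def j₂Hom (g : ℕ) (p₁ q₁ p₂ q₂ : ℤ) : Multiplicative ℤ × Multiplicative ℤ →* G g :=
  MonoidHom.mk' (fun e => j₂ g p₁ q₁ p₂ q₂ (e.1.toAdd, e.2.toAdd)) fun a b => by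
    have hc (m n : ℤ) : Commute (mu g ^ m) (lam g ^ n) :=
      ((commute_lam g _).symm.zpow_right n)
    simp only [j₂, Prod.fst_mul, Prod.snd_mul, toAdd_mul, mul_add]
    rw [add_add_add_comm, add_add_add_comm (q₁ * _), zpow_add, zpow_add (mu g),
      (hc _ _).mul_mul_mul_comm]

theorem mu_fst_ne_one {g : ℕ} (hg : 1 ≤ g) : (mu g).1 ≠ 1 := by
  obtain ⟨g, rfl⟩ := Nat.exists_eq_add_of_le' hg
  let f : F (g + 1) →* Equiv.Perm (Fin 3) := FreeGroup.lift fun x =>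
    if x.1 = 0 then (if x.2 then Equiv.swap 0 1 else Equiv.swap 1 2) else 1
  intro h
  have := congrArg f h
  simp only [mu, List.finRange_succ, List.map_cons, List.prod_cons, map_mul, map_list_prod,
    List.map_map, map_one] at this
  rw [List.prod_eq_one (l := List.map _ _)] at this
  · simp [f, commutatorElement_def] at this
    revert this
    decide
  · simp [f, commutatorElement_def]

theorem j₂_apply (g : ℕ) (p₁ q₁ p₂ q₂ : ℤ) (e : ℤ × ℤ) :
    j₂ g p₁ q₁ p₂ q₂ e =
      ((mu g).1 ^ (q₁ * e.1 + q₂ * e.2), Multiplicative.ofAdd (p₁ * e.1 + p₂ * e.2)) := by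
  simp only [j₂, lam, mu, Prod.pow_mk, Prod.mk_mul_mk, one_zpow, one_mul, mul_one, ← ofAdd_zsmul,
    smul_eq_mul]

theorem j₂Hom_injective {g : ℕ} (hg : 1 ≤ g) {p₁ q₁ p₂ q₂ : ℤ} (hdet : p₁ * q₂ - p₂ * q₁ ≠ 0) :
    Function.Injective (j₂Hom g p₁ q₁ p₂ q₂) := by
  rw [injective_iff_map_eq_one]
  rintro ⟨m, n⟩ h
  induction m using Multiplicative.rec with | _ m
  induction n using Multiplicative.rec with | _ n
  have h' : j₂ g p₁ q₁ p₂ q₂ (m, n) = 1 := h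
  rw [j₂_apply, Prod.mk_eq_one, IsMulTorsionFree.zpow_eq_one_iff_right (mu_fst_ne_one hg), ofAdd_eq_one] at h'
  obtain ⟨hq, hp⟩ := h'
  simp only at hq hp
  have hm : (p₁ * q₂ - p₂ * q₁) * m = 0 := by linear_combination q₂ * hp - p₂ * hq
  have hn : (p₁ * q₂ - p₂ * q₁) * n = 0 := by linear_combination p₁ * hq - q₁ * hp
  simp only [mul_eq_zero, hdet, false_or] at hm hn
  subst hm hn
  rfl

/-- The vertex groups of the amalgam, indexed by `Bool`. -/
abbrev vertexGroup (g₁ g₂ : ℕ) (b : Bool) : Type := G (cond b g₁ g₂)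

/-- The inclusions of `ℤ × ℤ` into the vertex groups. -/
def edgeHom (g₁ g₂ : ℕ) (p₁ q₁ p₂ q₂ : ℤ) :
    ∀ b, Multiplicative ℤ × Multiplicative ℤ →* vertexGroup g₁ g₂ b
  | true => j₂Hom g₁ 1 0 0 1
  | false => j₂Hom g₂ p₁ q₁ p₂ q₂

/-- The comparison map from the amalgam to Mathlib's pushout. -/
def toPushout (g₁ g₂ : ℕ) (p₁ q₁ p₂ q₂ : ℤ) :
    Amalgam g₁ g₂ p₁ q₁ p₂ q₂ →* PushoutI (edgeHom g₁ g₂ p₁ q₁ p₂ q₂) :=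
  QuotientGroup.lift _
    (Coprod.lift (PushoutI.of (φ := edgeHom g₁ g₂ p₁ q₁ p₂ q₂) true)
      (PushoutI.of (φ := edgeHom g₁ g₂ p₁ q₁ p₂ q₂) false)) <| by
    refine Subgroup.normalClosure_le_normal ?_
    rintro _ ⟨e, rfl⟩
    let e' := (Multiplicative.ofAdd e.1, Multiplicative.ofAdd e.2)
    have h₁ : j₁ g₁ e = edgeHom g₁ g₂ p₁ q₁ p₂ q₂ true e' := by
      simp [edgeHom, j₂Hom, j₁, j₂, e']
    have h₂ : j₂ g₂ p₁ q₁ p₂ q₂ e = edgeHom g₁ g₂ p₁ q₁ p₂ q₂ false e' := rfl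
    rw [SetLike.mem_coe, MonoidHom.mem_ker, map_mul, map_inv, Coprod.lift_apply_inl,
      Coprod.lift_apply_inr, mul_inv_eq_one, h₁, h₂]
    exact (PushoutI.of_apply_eq_base _ true e').trans (PushoutI.of_apply_eq_base _ false e').symm

theorem κ₂_injective {g₁ g₂ : ℕ} (hg₁ : 1 ≤ g₁) (hg₂ : 1 ≤ g₂) {p₁ q₁ p₂ q₂ : ℤ}
    (hdet : p₁ * q₂ - p₂ * q₁ ≠ 0) : Function.Injective (κ₂ g₁ g₂ p₁ q₁ p₂ q₂) := by
  refine Function.Injective.of_comp (f := toPushout g₁ g₂ p₁ q₁ p₂ q₂) ?_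
  have hφ : ∀ b, Function.Injective (edgeHom g₁ g₂ p₁ q₁ p₂ q₂ b)
    | true => j₂Hom_injective hg₁ (by simp)
    | false => j₂Hom_injective hg₂ hdet
  have : toPushout g₁ g₂ p₁ q₁ p₂ q₂ ∘ κ₂ g₁ g₂ p₁ q₁ p₂ q₂ =
      PushoutI.of (φ := edgeHom g₁ g₂ p₁ q₁ p₂ q₂) false := by
    ext x
    exact Coprod.lift_apply_inr (PushoutI.of (φ := edgeHom g₁ g₂ p₁ q₁ p₂ q₂) true)
      (PushoutI.of (φ := edgeHom g₁ g₂ p₁ q₁ p₂ q₂) false) x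
  rw [this]
  exact PushoutI.of_injective hφ false

theorem κ₁_j₁ (g₁ g₂ : ℕ) (p₁ q₁ p₂ q₂ : ℤ) (e : ℤ × ℤ) :
    κ₁ g₁ g₂ p₁ q₁ p₂ q₂ (j₁ g₁ e) = κ₂ g₁ g₂ p₁ q₁ p₂ q₂ (j₂ g₂ p₁ q₁ p₂ q₂ e) := by
  rw [← mul_inv_eq_one, ← map_inv]
  exact (QuotientGroup.eq_one_iff _).2 (Subgroup.subset_normalClosure ⟨e, by rw [map_inv]⟩)

theorem mu_mem_commutator (g : ℕ) : mu g ∈ commutator (G g) := by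
  have h : mu g = MonoidHom.inl (F g) (Multiplicative ℤ) (mu g).1 := rfl
  rw [h, mu, map_list_prod]
  refine Subgroup.list_prod_mem _ fun x hx => ?_
  simp only [List.map_map, List.mem_map, Function.comp_apply, map_commutatorElement] at hx
  obtain ⟨i, -, rfl⟩ := hx
  exact Subgroup.commutator_mem_commutator (Subgroup.mem_top _) (Subgroup.mem_top _)

theorem map_mem_commutator {A B : Type*} [Group A] [Group B] (f : A →* B) {x : A}
    (hx : x ∈ commutator A) : f x ∈ commutator B := by
  have := Subgroup.mem_map_of_mem f hx
  rw [commutator_def, Subgroup.map_commutator] at this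
  exact Subgroup.commutator_mono le_top le_top this

theorem κ₂_lam_zpow_mem_commutator (g₁ g₂ : ℕ) (p₁ q₁ p₂ q₂ : ℤ) :
    κ₂ g₁ g₂ p₁ q₁ p₂ q₂ (lam g₂ ^ p₂) ∈ commutator (Amalgam g₁ g₂ p₁ q₁ p₂ q₂) := by
  have h := κ₁_j₁ g₁ g₂ p₁ q₁ p₂ q₂ (0, 1)
  simp only [j₁, j₂, mul_zero, mul_one, zero_add, zpow_zero, zpow_one, one_mul, map_mul] at h
  rw [← mul_inv_eq_iff_eq_mul.2 h]
  exact mul_mem (map_mem_commutator _ (mu_mem_commutator g₁))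
    (inv_mem (map_mem_commutator _ (zpow_mem (mu_mem_commutator g₂) q₂)))

end SurfaceAmalgam

theorem FreeGroup.subsingleton_of_forall_commute {α : Type*}
    (h : ∀ x y : FreeGroup α, Commute x y) : Subsingleton α := by
  classical
  refine ⟨fun a b => ?_⟩
  by_contra hab
  let f : FreeGroup α →* Equiv.Perm (Fin 3) :=
    lift fun c => if c = a then Equiv.swap 0 1 else Equiv.swap 1 2
  have := ((h (of a) (of b)).map f).eq
  simp only [f, lift_apply_of, if_true, if_neg (Ne.symm hab)] at this
  revert this
  decide

theorem IsFreeGroup.isCyclic_of_forall_commute {A : Type*} [Group A] [IsFreeGroup A]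
    (h : ∀ x y : A, Commute x y) : IsCyclic A := by
  let e := IsFreeGroup.toFreeGroup A
  have : Subsingleton (IsFreeGroup.Generators A) :=
    FreeGroup.subsingleton_of_forall_commute fun x y => by
      simpa using (h (e.symm x) (e.symm y)).map e
  rcases isEmpty_or_nonempty (IsFreeGroup.Generators A) with _ | ⟨⟨a⟩⟩
  · have : Subsingleton A := e.toEquiv.subsingleton
    infer_instance
  · have := uniqueOfSubsingleton a
    exact (e.trans FreeGroup.mulEquivIntOfUnique).isCyclic.2 inferInstance

theorem not_isFreeGroup_int_prod_int : ¬ IsFreeGroup (Multiplicative ℤ × Multiplicative ℤ) :=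
  fun _ => not_isCyclic_prod_of_infinite_nontrivial (Multiplicative ℤ) (Multiplicative ℤ)
    (IsFreeGroup.isCyclic_of_forall_commute Commute.all)

theorem not_isFreeGroup_of_le {A : Type*} [Group A] {Z H : Subgroup A} (hZH : Z ≤ H)
    (e : Z ≃* Multiplicative ℤ × Multiplicative ℤ) : ¬ IsFreeGroup H := fun _ =>
  not_isFreeGroup_int_prod_int
    (IsFreeGroup.ofMulEquiv ((Subgroup.subgroupOfEquivOfLe hZH).trans e))

open SurfaceAmalgam in
/-- With `g₁, g₂ ≥ 1` and `p₁ q₂ − p₂ q₁ = 1`, in the amalgamated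
free product `G` of `G₁ = F₁ × ℤ` and `G₂ = F₂ × ℤ` along `E = ℤ × ℤ` via `j₁` and
`j₂`: if `p₂ ≠ 0`, then the intersection of the commutator subgroup `[G, G]` with the
image `κ₂(G₂)` contains a subgroup isomorphic to `ℤ × ℤ`, and hence is not a free
group. -/
theorem commutator_inf_image_not_free (g₁ g₂ : ℕ) (hg₁ : 1 ≤ g₁) (hg₂ : 1 ≤ g₂)
    (p₁ q₁ p₂ q₂ : ℤ) (hdet : p₁ * q₂ - p₂ * q₁ = 1) (hp₂ : p₂ ≠ 0) :
    (∃ Z : Subgroup (Amalgam g₁ g₂ p₁ q₁ p₂ q₂),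
        Z ≤ commutator (Amalgam g₁ g₂ p₁ q₁ p₂ q₂) ⊓ (κ₂ g₁ g₂ p₁ q₁ p₂ q₂).range ∧
          Nonempty (Z ≃* Multiplicative ℤ × Multiplicative ℤ)) ∧
      ¬ IsFreeGroup
          ↥(commutator (Amalgam g₁ g₂ p₁ q₁ p₂ q₂) ⊓ (κ₂ g₁ g₂ p₁ q₁ p₂ q₂).range) := by
  have hsub : ∃ Z : Subgroup (Amalgam g₁ g₂ p₁ q₁ p₂ q₂),
      Z ≤ commutator (Amalgam g₁ g₂ p₁ q₁ p₂ q₂) ⊓ (κ₂ g₁ g₂ p₁ q₁ p₂ q₂).range ∧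
        Nonempty (Z ≃* Multiplicative ℤ × Multiplicative ℤ) := by
    let f := (κ₂ g₁ g₂ p₁ q₁ p₂ q₂).comp (j₂Hom g₂ p₂ 0 0 1)
    have hf : Function.Injective f :=
      (κ₂_injective hg₁ hg₂ (by simp [hdet])).comp (j₂Hom_injective hg₂ (by simpa using hp₂))
    refine ⟨f.range, ?_, ⟨(MonoidHom.ofInjective hf).symm⟩⟩
    rintro _ ⟨e, rfl⟩
    refine ⟨?_, j₂Hom g₂ p₂ 0 0 1 e, rfl⟩
    have he : f e = κ₂ g₁ g₂ p₁ q₁ p₂ q₂ (lam g₂ ^ p₂) ^ e.1.toAdd *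
        κ₂ g₁ g₂ p₁ q₁ p₂ q₂ (mu g₂) ^ e.2.toAdd := by
      simp [f, j₂Hom, j₂, zpow_mul]
    rw [he]
    exact Subgroup.mul_mem _ (Subgroup.zpow_mem _ (κ₂_lam_zpow_mem_commutator g₁ g₂ p₁ q₁ p₂ q₂) _)
      (Subgroup.zpow_mem _ (map_mem_commutator _ (mu_mem_commutator g₂)) _)
  obtain ⟨Z, hZ, ⟨e⟩⟩ := hsub
  exact ⟨⟨Z, hZ, ⟨e⟩⟩, not_isFreeGroup_of_le hZ e⟩
end
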